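/- Let u : ℝ³ → ℝ be a smooth solution of the rdDym equation u_ty = u_x u_xy − u_y u_xx with u_y nowhere vanishing. Let χ : ℝ³ → ℝ be a smooth solution of the linearized rdDym equation ℓ_E(χ) = 0, and suppose χ̂ : ℝ³ → ℝ is a smooth function satisfying the first-order system ∂_t χ̂ = u_y⁻¹ ( u_y ∂_x χ − u_x ∂_y χ + (u_x u_xy − u_y u_xx) χ̂ ) and ∂_x χ̂ = u_y⁻¹ ( u_xy χ̂ − ∂_y χ ). Then χ̂ also satisfies ℓ_E(χ̂) = 0. (The system defines a recursion operator R₊ for shadows of symmetries of the rdDym equation.) -/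

import Mathlib

noncomputable section

/-- Partial derivative with respect to the first variable (`x`). -/
def Dx (f : ℝ → ℝ → ℝ → ℝ) (x y t : ℝ) : ℝ := deriv (fun x' => f x' y t) x

/-- Partial derivative with respect to the second variable (`y`). -/
def Dy (f : ℝ → ℝ → ℝ → ℝ) (x y t : ℝ) : ℝ := deriv (fun y' => f x y' t) y

/-- Partial derivative with respect to the third variable (`t`). -/
def Dt (f : ℝ → ℝ → ℝ → ℝ) (x y t : ℝ) : ℝ := deriv (fun t' => f x y t') t

/-- Smoothness of a function of three real variables `(x, y, t)`. -/
def Smooth3 (f : ℝ → ℝ → ℝ → ℝ) : Prop :=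
  ContDiff ℝ (⊤ : ℕ∞) (fun p : ℝ × ℝ × ℝ => f p.1 p.2.1 p.2.2)

/-- Linearization of the rdDym equation `u_ty = u_x u_xy - u_y u_xx` at a solution `u`. -/
def linRdDym (u φ : ℝ → ℝ → ℝ → ℝ) (x y t : ℝ) : ℝ :=
  Dt (Dy φ) x y t - Dx u x y t * Dx (Dy φ) x y t + Dy u x y t * Dx (Dx φ) x y t
    - Dx (Dy u) x y t * Dx φ x y t + Dx (Dx u) x y t * Dy φ x y t

/-- Uncurrying of a function of three real variables. -/
def uncurry3 (f : ℝ → ℝ → ℝ → ℝ) (p : ℝ × ℝ × ℝ) : ℝ := f p.1 p.2.1 p.2.2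

theorem Smooth3.contDiff_uncurry3 {f : ℝ → ℝ → ℝ → ℝ} (hf : Smooth3 f) :
    ContDiff ℝ (⊤ : ℕ∞) (uncurry3 f) := hf

theorem Smooth3.hasFDerivAt {f : ℝ → ℝ → ℝ → ℝ} (hf : Smooth3 f) (p : ℝ × ℝ × ℝ) :
    HasFDerivAt (uncurry3 f) (fderiv ℝ (uncurry3 f) p) p :=
  (hf.contDiff_uncurry3.differentiable (by simp) p).hasFDerivAt

theorem Smooth3.hasDerivAt_x_fderiv {f : ℝ → ℝ → ℝ → ℝ} (hf : Smooth3 f) (x y t : ℝ) :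
    HasDerivAt (fun x' => f x' y t) (fderiv ℝ (uncurry3 f) (x, y, t) (1, 0, 0)) x :=
  HasFDerivAt.comp_hasDerivAt (l := uncurry3 f) x (hf.hasFDerivAt (x, y, t))
    ((hasDerivAt_id x).prodMk ((hasDerivAt_const x y).prodMk (hasDerivAt_const x t)))

theorem Smooth3.hasDerivAt_y_fderiv {f : ℝ → ℝ → ℝ → ℝ} (hf : Smooth3 f) (x y t : ℝ) :
    HasDerivAt (fun y' => f x y' t) (fderiv ℝ (uncurry3 f) (x, y, t) (0, 1, 0)) y :=
  HasFDerivAt.comp_hasDerivAt (l := uncurry3 f) y (hf.hasFDerivAt (x, y, t))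
    ((hasDerivAt_const y x).prodMk ((hasDerivAt_id y).prodMk (hasDerivAt_const y t)))

theorem Smooth3.hasDerivAt_t_fderiv {f : ℝ → ℝ → ℝ → ℝ} (hf : Smooth3 f) (x y t : ℝ) :
    HasDerivAt (fun t' => f x y t') (fderiv ℝ (uncurry3 f) (x, y, t) (0, 0, 1)) t :=
  HasFDerivAt.comp_hasDerivAt (l := uncurry3 f) t (hf.hasFDerivAt (x, y, t))
    ((hasDerivAt_const t x).prodMk ((hasDerivAt_const t y).prodMk (hasDerivAt_id t)))

theorem Smooth3.hasDerivAt_x {f : ℝ → ℝ → ℝ → ℝ} (hf : Smooth3 f) (x y t : ℝ) :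
    HasDerivAt (fun x' => f x' y t) (Dx f x y t) x :=
  (hf.hasDerivAt_x_fderiv x y t).differentiableAt.hasDerivAt

theorem Smooth3.hasDerivAt_y {f : ℝ → ℝ → ℝ → ℝ} (hf : Smooth3 f) (x y t : ℝ) :
    HasDerivAt (fun y' => f x y' t) (Dy f x y t) y :=
  (hf.hasDerivAt_y_fderiv x y t).differentiableAt.hasDerivAt

theorem Smooth3.uncurry3_Dx {f : ℝ → ℝ → ℝ → ℝ} (hf : Smooth3 f) :
    uncurry3 (Dx f) = fun p => fderiv ℝ (uncurry3 f) p (1, 0, 0) :=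
  funext fun p => (hf.hasDerivAt_x_fderiv p.1 p.2.1 p.2.2).deriv

theorem Smooth3.uncurry3_Dy {f : ℝ → ℝ → ℝ → ℝ} (hf : Smooth3 f) :
    uncurry3 (Dy f) = fun p => fderiv ℝ (uncurry3 f) p (0, 1, 0) :=
  funext fun p => (hf.hasDerivAt_y_fderiv p.1 p.2.1 p.2.2).deriv

theorem Smooth3.uncurry3_Dt {f : ℝ → ℝ → ℝ → ℝ} (hf : Smooth3 f) :
    uncurry3 (Dt f) = fun p => fderiv ℝ (uncurry3 f) p (0, 0, 1) :=
  funext fun p => (hf.hasDerivAt_t_fderiv p.1 p.2.1 p.2.2).deriv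

theorem Smooth3.contDiff_fderiv_apply {f : ℝ → ℝ → ℝ → ℝ} (hf : Smooth3 f) (v : ℝ × ℝ × ℝ) :
    ContDiff ℝ (⊤ : ℕ∞) fun p => fderiv ℝ (uncurry3 f) p v :=
  (hf.contDiff_uncurry3.fderiv_right (by simp)).clm_apply contDiff_const

theorem Smooth3.Dx {f : ℝ → ℝ → ℝ → ℝ} (hf : Smooth3 f) : Smooth3 (Dx f) := by
  change ContDiff ℝ (⊤ : ℕ∞) (uncurry3 (_root_.Dx f))
  rw [hf.uncurry3_Dx]
  exact hf.contDiff_fderiv_apply _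

theorem Smooth3.Dy {f : ℝ → ℝ → ℝ → ℝ} (hf : Smooth3 f) : Smooth3 (Dy f) := by
  change ContDiff ℝ (⊤ : ℕ∞) (uncurry3 (_root_.Dy f))
  rw [hf.uncurry3_Dy]
  exact hf.contDiff_fderiv_apply _

theorem Smooth3.Dt {f : ℝ → ℝ → ℝ → ℝ} (hf : Smooth3 f) : Smooth3 (Dt f) := by
  change ContDiff ℝ (⊤ : ℕ∞) (uncurry3 (_root_.Dt f))
  rw [hf.uncurry3_Dt]
  exact hf.contDiff_fderiv_apply _

theorem Smooth3.fderiv_fderiv_apply_comm {f : ℝ → ℝ → ℝ → ℝ} (hf : Smooth3 f)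
    (p v w : ℝ × ℝ × ℝ) :
    fderiv ℝ (fun q => fderiv ℝ (uncurry3 f) q v) p w =
      fderiv ℝ (fun q => fderiv ℝ (uncurry3 f) q w) p v := by
  have hd : DifferentiableAt ℝ (fderiv ℝ (uncurry3 f)) p :=
    (hf.contDiff_uncurry3.fderiv_right (m := (⊤ : ℕ∞)) (by simp)).differentiable (by simp) p
  have hsymm : IsSymmSndFDerivAt ℝ (uncurry3 f) p :=
    hf.contDiff_uncurry3.contDiffAt.isSymmSndFDerivAt
      (by simpa using WithTop.coe_le_coe.2 (le_top : (2 : ℕ∞) ≤ ⊤))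
  rw [fderiv_clm_apply hd (differentiableAt_const v), fderiv_clm_apply hd (differentiableAt_const w)]
  simpa using hsymm.eq w v

theorem Smooth3.Dx_Dy_comm {f : ℝ → ℝ → ℝ → ℝ} (hf : Smooth3 f) (x y t : ℝ) :
    _root_.Dx (_root_.Dy f) x y t = _root_.Dy (_root_.Dx f) x y t := by
  refine (hf.Dy.hasDerivAt_x_fderiv x y t).deriv.trans
    (Eq.trans ?_ (hf.Dx.hasDerivAt_y_fderiv x y t).deriv.symm)
  rw [hf.uncurry3_Dx, hf.uncurry3_Dy, hf.fderiv_fderiv_apply_comm]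

theorem Smooth3.Dt_Dy_comm {f : ℝ → ℝ → ℝ → ℝ} (hf : Smooth3 f) (x y t : ℝ) :
    _root_.Dt (_root_.Dy f) x y t = _root_.Dy (_root_.Dt f) x y t := by
  refine (hf.Dy.hasDerivAt_t_fderiv x y t).deriv.trans
    (Eq.trans ?_ (hf.Dt.hasDerivAt_y_fderiv x y t).deriv.symm)
  rw [hf.uncurry3_Dt, hf.uncurry3_Dy, hf.fderiv_fderiv_apply_comm]

/-- The direct recursion operator `R₊` of the rdDym equation maps shadows to shadows. -/
theorem rdDym_recursion_plus
    (u : ℝ → ℝ → ℝ → ℝ) (hu : Smooth3 u)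
    (husol : ∀ x y t : ℝ, Dt (Dy u) x y t = Dx u x y t * Dx (Dy u) x y t - Dy u x y t * Dx (Dx u) x y t)
    (huy : ∀ x y t : ℝ, Dy u x y t ≠ 0)
    (χ : ℝ → ℝ → ℝ → ℝ) (hχ : Smooth3 χ)
    (hχsh : ∀ x y t : ℝ, linRdDym u χ x y t = 0)
    (χhat : ℝ → ℝ → ℝ → ℝ) (hχhat : Smooth3 χhat)
    (hsys_t : ∀ x y t : ℝ,
      Dt χhat x y t = (Dy u x y t)⁻¹ *
        (Dy u x y t * Dx χ x y t - Dx u x y t * Dy χ x y t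
          + (Dx u x y t * Dx (Dy u) x y t - Dy u x y t * Dx (Dx u) x y t) * χhat x y t))
    (hsys_x : ∀ x y t : ℝ,
      Dx χhat x y t = (Dy u x y t)⁻¹ *
        (Dx (Dy u) x y t * χhat x y t - Dy χ x y t)) :
    ∀ x y t : ℝ, linRdDym u χhat x y t = 0 := by
  intro x y t
  have hx : ∀ x y t, Dy u x y t * Dx χhat x y t =
      Dx (Dy u) x y t * χhat x y t - Dy χ x y t := fun x y t => by
    rw [hsys_x, mul_inv_cancel_left₀ (huy x y t)]
  have ht : ∀ x y t, Dt χhat x y t =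
      Dx χ x y t + Dx u x y t * Dx χhat x y t - Dx (Dx u) x y t * χhat x y t := fun x y t => by
    refine mul_left_cancel₀ (huy x y t) ?_
    rw [hsys_t, mul_inv_cancel_left₀ (huy x y t)]
    linear_combination -Dx u x y t * hx x y t
  have hxx := ((hu.Dy.hasDerivAt_x x y t).mul (hχhat.Dx.hasDerivAt_x x y t)).unique
    ((((hu.Dy.Dx.hasDerivAt_x x y t).mul (hχhat.hasDerivAt_x x y t)).sub
      (hχ.Dy.hasDerivAt_x x y t)).congr_of_eventuallyEq (.of_forall fun x' => hx x' y t))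
  have hty := (hχhat.Dt.hasDerivAt_y x y t).unique
    ((((hχ.Dx.hasDerivAt_y x y t).add
      ((hu.Dx.hasDerivAt_y x y t).mul (hχhat.Dx.hasDerivAt_y x y t))).sub
      ((hu.Dx.Dx.hasDerivAt_y x y t).mul (hχhat.hasDerivAt_y x y t))).congr_of_eventuallyEq
        (.of_forall fun y' => ht x y' t))
  have huxy : Dy (Dx u) = Dx (Dy u) := by
    funext x y t
    exact (hu.Dx_Dy_comm x y t).symm
  rw [← hχhat.Dt_Dy_comm, ← hχ.Dx_Dy_comm, ← hχhat.Dx_Dy_comm, ← hu.Dx.Dx_Dy_comm, huxy] at hty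
  unfold linRdDym
  linear_combination hty + hxx
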